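/- arXiv:1111.3548 — 2 statements merged into one kernel-verified Lean document; each statement's English description precedes it below -/
import Mathlib

section
/- Let G be a finite simple graph with a block contig (r, β) on ZMod n, let a ≠ b be points that are non-adjacent in 𝒢(r), and let v ∈ β⁻¹(a) and w ∈ β⁻¹(b). If the graph G + vw is a PCA graph but not a PIG graph, and the complements of G ∖ {v} and of G ∖ {w} are both connected, then at least one of ⟨a, b⟩ and ⟨b, a⟩ is connectable. -/
open Classical

noncomputable section

def IsRoundRep (n : ℕ) (r : ZMod n → ℕ) : Prop :=
  (∀ i, r i < n) ∧ (∀ i, r i ≤ r (i + 1) + 1)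

def Arrow {n : ℕ} (r : ZMod n → ℕ) (i j : ZMod n) : Prop :=
  ∃ k : ℕ, 1 ≤ k ∧ k ≤ r i ∧ j = i + (k : ZMod n)

def Fr {n : ℕ} (r : ZMod n → ℕ) (i : ZMod n) : ZMod n := i + (r i : ZMod n)

def Fl {n : ℕ} (r : ZMod n → ℕ) (i : ZMod n) : ZMod n :=
  i - (({j : ZMod n | Arrow r j i}).ncard : ZMod n)

def Nr {n : ℕ} (r : ZMod n → ℕ) (i : ZMod n) : ZMod n :=
  if Arrow r i (i + 1) then i + 1 else i

def Nl {n : ℕ} (r : ZMod n → ℕ) (i : ZMod n) : ZMod n :=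
  if Arrow r (i - 1) i then i - 1 else i

def Ur {n : ℕ} (r : ZMod n → ℕ) (i : ZMod n) : ZMod n := Fr r i + 1

def Ul {n : ℕ} (r : ZMod n → ℕ) (i : ZMod n) : ZMod n := Fl r i - 1

def IsNormal {n : ℕ} (r : ZMod n → ℕ) : Prop :=
  ∀ i j : ZMod n, i ≠ j → ¬(Arrow r i j ∧ Arrow r j i)

def roundGraph {n : ℕ} (r : ZMod n → ℕ) : SimpleGraph (ZMod n) :=
  SimpleGraph.fromRel (Arrow r)

def IsStraight {n : ℕ} (r : ZMod n → ℕ) : Prop := ∃ i, r i = 0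

def cyclicRange {n : ℕ} (a b : ZMod n) : Set (ZMod n) :=
  {x | ∃ k : ℕ, k ≤ (b - a).val ∧ x = a + (k : ZMod n)}

def cyclicRangeCO {n : ℕ} (a b : ZMod n) : Set (ZMod n) := cyclicRange a b \ {b}

def cyclicRangeOC {n : ℕ} (a b : ZMod n) : Set (ZMod n) := cyclicRange a b \ {a}

def cyclicRangeOO {n : ℕ} (a b : ZMod n) : Set (ZMod n) := cyclicRange a b \ {a, b}

def coNbhd {V : Type*} (G : SimpleGraph V) (v : V) : Set V :=
  {w | w ≠ v ∧ ¬ G.Adj v w}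

def coNbhdSet {V : Type*} (G : SimpleGraph V) (S : Set V) : Set V :=
  ⋃ v ∈ S, coNbhd G v

def IsBipartite {V : Type*} (G : SimpleGraph V) : Prop :=
  ∃ S : Set V, ∀ v w, G.Adj v w → (v ∈ S ↔ w ∉ S)

def IsUniversalPt {n : ℕ} (r : ZMod n → ℕ) (i : ZMod n) : Prop :=
  ∀ j, j ≠ i → (roundGraph r).Adj i j

def Compressed {n : ℕ} (r : ZMod n → ℕ) : Prop :=
  ∀ i j : ZMod n, Fl r i = Fl r j → Fr r i = Fr r j → i = j

def IsRoundRepOf {V : Type*} (G : SimpleGraph V) (n : ℕ) (r : ZMod n → ℕ)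
    (β : V → ZMod n) : Prop :=
  IsRoundRep n r ∧ IsNormal r ∧ Function.Surjective β ∧
    ∀ u v : V, u ≠ v → (G.Adj u v ↔ (β u = β v ∨ (roundGraph r).Adj (β u) (β v)))

def IsPCA {V : Type*} (G : SimpleGraph V) : Prop :=
  ∃ n : ℕ, 1 ≤ n ∧ ∃ (r : ZMod n → ℕ) (β : V → ZMod n), IsRoundRepOf G n r β

def IsPIG {V : Type*} (G : SimpleGraph V) : Prop :=
  ∃ n : ℕ, 1 ≤ n ∧ ∃ (r : ZMod n → ℕ) (β : V → ZMod n),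
    IsRoundRepOf G n r β ∧ IsStraight r

def IsBlockContigOf {V : Type*} (G : SimpleGraph V) (n : ℕ) (r : ZMod n → ℕ)
    (β : V → ZMod n) : Prop :=
  IsRoundRepOf G n r β ∧ Compressed r ∧
    {i : ZMod n | IsUniversalPt r i}.Subsingleton ∧ (roundGraph r).Connected

def Disconnectable {n : ℕ} (r : ZMod n → ℕ) (a b : ZMod n) : Prop :=
  b = Fr r a ∧ a = Fl r b

def Connectable {n : ℕ} (r : ZMod n → ℕ) (a b : ZMod n) : Prop :=
  b = Ur r a ∧ a = Ul r b

def addEdge {V : Type*} (G : SimpleGraph V) (v w : V) : SimpleGraph V :=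
  G ⊔ SimpleGraph.fromRel (fun x y => x = v ∧ y = w)

def IsCoContigChunk {n : ℕ} (r : ZMod n → ℕ) (S : Set (ZMod n)) : Prop :=
  (∃ a b : ZMod n, S = cyclicRange a b) ∧
  ∃ X : Set (ZMod n), S ⊆ X ∧
    (∃ C : ((roundGraph r)ᶜ).ConnectedComponent,
      X ∪ coNbhdSet (roundGraph r) X = C.supp) ∧
    X ∩ coNbhdSet (roundGraph r) X = ∅ ∧
    (roundGraph r).IsClique X ∧ (roundGraph r).IsClique (coNbhdSet (roundGraph r) X)

def phi {n : ℕ} (w : ZMod (n + 1)) (k : ZMod n) : ZMod (n + 1) :=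
  w + 1 + (k.val : ZMod (n + 1))

def removePt {n : ℕ} (s : ZMod (n + 1) → ℕ) (w : ZMod (n + 1)) (k : ZMod n) : ℕ :=
  if Arrow s (phi w k) w then s (phi w k) - 1 else s (phi w k)

def Receptive {n : ℕ} (r : ZMod n → ℕ) (Bl Br : ZMod n) : Prop :=
  ∃ (s : ZMod (n + 1) → ℕ) (w : ZMod (n + 1)),
    IsRoundRep (n + 1) s ∧ IsNormal s ∧ (roundGraph s).Connected ∧
    Fl s w ≠ w ∧ Fr s w ≠ w ∧ removePt s w = r ∧
    phi w Bl = Fl s w ∧ phi w Br = Fr s w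

def dominoGraph : SimpleGraph (Fin 6) :=
  SimpleGraph.fromRel (fun i j =>
    (i, j) = (0, 1) ∨ (i, j) = (1, 2) ∨ (i, j) = (3, 4) ∨ (i, j) = (4, 5) ∨
    (i, j) = (0, 3) ∨ (i, j) = (1, 4) ∨ (i, j) = (2, 5))

def pGraph : SimpleGraph (Fin 5) :=
  SimpleGraph.fromRel (fun i j =>
    (i, j) = (0, 1) ∨ (i, j) = (1, 2) ∨ (i, j) = (3, 4) ∨
    (i, j) = (0, 3) ∨ (i, j) = (1, 4))

def AlmostConnectable {V : Type*} {n : ℕ} (r : ZMod n → ℕ) (β : V → ZMod n)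
    (a b : ZMod n) : Prop :=
  (∃ v : V, β ⁻¹' {a} = {v}) ∧ (∃ w : V, β ⁻¹' {b} = {w}) ∧
  ∃ (hab : a ≠ b) (C : (((roundGraph r).induce {x : ZMod n | x ≠ b})ᶜ).ConnectedComponent)
    (D : Set (ZMod n)),
      (⟨a, hab⟩ : {x : ZMod n | x ≠ b}) ∈ C.supp ∧
      D = Subtype.val '' C.supp ∧
      Nonempty ((roundGraph r).induce D ≃g pGraphᶜ) ∧
      Nonempty ((roundGraph r).induce (D ∪ {b}) ≃g dominoGraphᶜ) ∧
      Nonempty ((roundGraph r).induce ((D ∪ {b}) \ {a}) ≃g pGraphᶜ)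

/-- An orientation of part of the edges of `K` in which both ends of every induced path on three
vertices are oriented consistently along the path. -/
structure IsLocalOrientation {X : Type*} (K : SimpleGraph X) (D : X → X → Prop) : Prop where
  asymm : ∀ x y, D x y → ¬ D y x
  path : ∀ x y z, K.Adj x y → K.Adj x z → y ≠ z → ¬ K.Adj y z →
    (D y x ∧ D x z) ∨ (D z x ∧ D x y)

/-- The vertex `z` is adjacent to exactly one of the two other vertices `x` and `y`. -/
def Distinguishes {X : Type*} (K : SimpleGraph X) (x y z : X) : Prop :=
  z ≠ x ∧ z ≠ y ∧ ((K.Adj x z ∧ ¬ K.Adj y z) ∨ (¬ K.Adj x z ∧ K.Adj y z))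

/-- An edge whose ends are distinguished by a third vertex. -/
def IsPathEdge {X : Type*} (K : SimpleGraph X) (x y : X) : Prop :=
  K.Adj x y ∧ ∃ z, Distinguishes K x y z

/-- The ordered pairs obtained from `(p, q)` by swapping and by passing from one edge of an induced
path on three vertices to the other. -/
inductive ForcingClass {X : Type*} (K : SimpleGraph X) (p q : X) : X → X → Prop
  | refl : ForcingClass K p q p q
  | swap {x y : X} : ForcingClass K p q x y → ForcingClass K p q y x
  | step {x y z : X} : ForcingClass K p q x y → K.Adj x z → y ≠ z → ¬ K.Adj y z →
      ForcingClass K p q x z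

theorem IsLocalOrientation.flip {X : Type*} {K : SimpleGraph X} {D : X → X → Prop}
    (h : IsLocalOrientation K D) : IsLocalOrientation K (fun x y => D y x) where
  asymm x y := h.asymm y x
  path x y z hy hz hne hn := by
    rcases h.path x y z hy hz hne hn with h | h
    · exact Or.inr ⟨h.2, h.1⟩
    · exact Or.inl ⟨h.2, h.1⟩

theorem IsLocalOrientation.claw_free {X : Type*} {K : SimpleGraph X} {D : X → X → Prop}
    (h : IsLocalOrientation K D) {t x y z : X} (hx : K.Adj t x) (hy : K.Adj t y)
    (hz : K.Adj t z) (hxy : x ≠ y) (hxz : x ≠ z) (hyz : y ≠ z) (nxy : ¬ K.Adj x y)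
    (nxz : ¬ K.Adj x z) (nyz : ¬ K.Adj y z) : False := by
  have h1 := h.path t x y hx hy hxy nxy
  have h2 := h.path t x z hx hz hxz nxz
  have h3 := h.path t y z hy hz hyz nyz
  have ax := h.asymm t x
  have ay := h.asymm t y
  have az := h.asymm t z
  tauto

theorem IsPathEdge.symm {X : Type*} {K : SimpleGraph X} {x y : X} (h : IsPathEdge K x y) :
    IsPathEdge K y x := by
  obtain ⟨h, z, h1, h2, h3⟩ := h
  exact ⟨h.symm, z, h2, h1, by tauto⟩

theorem ForcingClass.isPathEdge {X : Type*} {K : SimpleGraph X} {p q : X}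
    (hpq : IsPathEdge K p q) {x y : X} (h : ForcingClass K p q x y) : IsPathEdge K x y := by
  induction h with
  | refl => exact hpq
  | swap _ ih => exact ih.symm
  | @step x y z _ hz hne hn ih =>
    exact ⟨hz, y, ih.1.ne', hne, Or.inl ⟨ih.1, fun h => hn h.symm⟩⟩

theorem exists_boundary_adj {X : Type*} {K : SimpleGraph X} (hK : K.Preconnected) (S : Set X)
    {x y : X} (hx : x ∈ S) (hy : y ∉ S) : ∃ s ∈ S, ∃ t ∉ S, K.Adj s t := by
  obtain ⟨p⟩ := hK x y
  obtain ⟨d, -, h1, h2⟩ := p.exists_boundary_dart S hx hy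
  exact ⟨d.fst, h1, d.snd, h2, d.adj⟩

theorem ForcingClass.adj_iff {X : Type*} {K : SimpleGraph X} {p q u : X}
    (hu : ∀ y, ¬ ForcingClass K p q u y) {x y : X}
    (h : ForcingClass K p q x y) : K.Adj u x ↔ K.Adj u p := by
  have key : ∀ {x y : X}, ForcingClass K p q x y → K.Adj u x → K.Adj u y := by
    intro x y h hx
    by_contra hy
    refine hu x (.swap (.step h hx.symm ?_ (fun h => hy h.symm)))
    rintro rfl
    exact hu x h.swap
  induction h with
  | refl => rfl
  | swap h ih => exact ⟨fun hx => ih.1 (key h.swap hx), fun hx => key h (ih.2 hx)⟩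
  | step _ _ _ _ ih => exact ih

/-- In a connected co-connected graph with a local orientation, every forcing class of an edge with
distinguishable ends covers all vertices. -/
theorem ForcingClass.exists_of_isPathEdge {X : Type*} {K : SimpleGraph X} {D : X → X → Prop}
    (hD : IsLocalOrientation K D) (hK : K.Preconnected) (hKc : Kᶜ.Preconnected) {p q : X}
    (hpq : IsPathEdge K p q) (u : X) : ∃ y, ForcingClass K p q u y := by
  by_contra hu
  obtain ⟨s, ⟨s', hs⟩, t, ht, hst⟩ :=
    exists_boundary_adj hKc {u | ∃ y, ForcingClass K p q u y} ⟨q, .refl⟩ hu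
  simp only [Set.mem_ofPred_eq, not_exists] at ht
  have hcov : ∃ y z, y ≠ z ∧ ¬ K.Adj y z ∧
      (∃ y', ForcingClass K p q y y') ∧ ∃ z', ForcingClass K p q z z' := by
    obtain ⟨h, z, h1, h2, h3 | h3⟩ := hpq
    · exact ⟨q, z, h2.symm, h3.2, ⟨p, .swap .refl⟩,
        ⟨p, .swap (.step .refl h3.1 h2.symm h3.2)⟩⟩
    · exact ⟨p, z, h1.symm, h3.1, ⟨q, .refl⟩,
        ⟨q, .swap (.step (.swap .refl) h3.2 h1.symm h3.1)⟩⟩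
  obtain ⟨y, z, hyz, nyz, ⟨y', hy'⟩, ⟨z', hz'⟩⟩ := hcov
  have htp : ¬ K.Adj t p := fun h =>
    hst.2 ((ForcingClass.adj_iff ht hs).2 h).symm
  obtain ⟨a, ⟨ha, hap⟩, b, hb, hab⟩ := exists_boundary_adj hK
    {u | (∀ y, ¬ ForcingClass K p q u y) ∧ ¬ K.Adj u p} (x := t) (y := p) ⟨ht, htp⟩
    (fun h => h.1 q .refl)
  have hbM : ∀ y, ¬ ForcingClass K p q b y := fun y h =>
    hap ((ForcingClass.adj_iff ha h).1 hab)
  have hbp : K.Adj b p := by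
    by_contra h
    exact hb ⟨hbM, h⟩
  refine hD.claw_free hab.symm ((ForcingClass.adj_iff hbM hy').2 hbp)
    ((ForcingClass.adj_iff hbM hz').2 hbp) ?_ ?_ hyz
    (fun h => hap ((ForcingClass.adj_iff ha hy').1 h))
    (fun h => hap ((ForcingClass.adj_iff ha hz').1 h)) nyz
  · rintro rfl
    exact ha y' hy'
  · rintro rfl
    exact ha _ ‹_›

/-- A vertex forming a triangle with an edge, both of whose other sides lie outside the forcing
class of that edge, is not covered by the class. -/
theorem ForcingClass.not_of_triangle {X : Type*} {K : SimpleGraph X} {p q u : X}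
    (hp : K.Adj u p) (hq : K.Adj u q) (np : ¬ ForcingClass K p q u p)
    (nq : ¬ ForcingClass K p q u q) (y : X) : ¬ ForcingClass K p q u y := by
  have key : ∀ {x y : X}, ForcingClass K p q x y → K.Adj u x ∧ K.Adj u y ∧
      ¬ ForcingClass K p q u x ∧ ¬ ForcingClass K p q u y := by
    intro x y h
    induction h with
    | refl => exact ⟨hp, hq, np, nq⟩
    | swap _ ih => exact ⟨ih.2.1, ih.1, ih.2.2.2, ih.2.2.1⟩
    | @step x y z h hz hne hn ih =>
      have huz : K.Adj u z := by
        by_contra hc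
        by_cases huz : u = z
        · subst huz
          exact ih.2.2.1 (.swap (.step h hz hne hn))
        · exact ih.2.2.1 (.swap (.step (.step h hz hne hn) ih.1.symm (Ne.symm huz)
            fun h => hc h.symm))
      exact ⟨ih.1, huz, ih.2.2.1, fun hc => ih.2.2.2
        (.step hc ih.2.1 hne.symm fun h => hn h.symm)⟩
  exact fun h => (key h).1.ne rfl

/-- Uniqueness, up to reversal, of the local orientation of a connected co-connected graph. -/
theorem IsLocalOrientation.agree_or_flip {X : Type*} {K : SimpleGraph X} {D E : X → X → Prop}
    (hD : IsLocalOrientation K D) (hE : IsLocalOrientation K E) (hK : K.Preconnected)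
    (hKc : Kᶜ.Preconnected) :
    (∀ x y, IsPathEdge K x y → (D x y ∧ E x y) ∨ (D y x ∧ E y x)) ∨
    (∀ x y, IsPathEdge K x y → (D x y ∧ E y x) ∨ (D y x ∧ E x y)) := by
  have oriented : ∀ {D : X → X → Prop}, IsLocalOrientation K D → ∀ x y, IsPathEdge K x y →
      D x y ∨ D y x := by
    rintro D hD x y ⟨h, z, h1, h2, h3 | h3⟩
    · rcases hD.path x y z h h3.1 h2.symm h3.2 with h | h
      exacts [Or.inr h.1, Or.inl h.2]
    · rcases hD.path y x z h.symm h3.2 h1.symm h3.1 with h | h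
      exacts [Or.inl h.1, Or.inr h.2]
  have same : ∀ {E : X → X → Prop}, IsLocalOrientation K E → ∀ {p q x y : X}, IsPathEdge K p q →
      ((D p q ∧ E p q) ∨ (D q p ∧ E q p)) → ForcingClass K p q x y →
      (D x y ∧ E x y) ∨ (D y x ∧ E y x) := by
    intro E hE p q x y hpq h0 h
    induction h with
    | refl => exact h0
    | swap _ ih => exact ih.symm
    | @step x y z h hz hne hn ih =>
      have hxy := (h.isPathEdge hpq).1
      have h1 := hD.path x y z hxy hz hne hn
      have h2 := hE.path x y z hxy hz hne hn
      have := hD.asymm x y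
      have := hE.asymm x y
      tauto
  by_contra hcon
  push Not at hcon
  obtain ⟨⟨p', q', hp', n1⟩, ⟨p, q, hp, n2⟩⟩ := hcon
  have s1 : (D p q ∧ E p q) ∨ (D q p ∧ E q p) := by
    have := oriented hD p q hp
    have := oriented hE p q hp
    tauto
  have s2' : (D p' q' ∧ E q' p') ∨ (D q' p' ∧ E p' q') := by
    have := oriented hD p' q' hp'
    have := oriented hE p' q' hp'
    tauto
  obtain ⟨z, hz⟩ := ForcingClass.exists_of_isPathEdge hD hK hKc hp' p
  have hpz := hz.isPathEdge hp'
  have s2 : (D p z ∧ E z p) ∨ (D z p ∧ E p z) := same hE.flip hp' s2' hz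
  have disj : ∀ x y, ForcingClass K p q x y → ¬ ForcingClass K p z x y := by
    intro x y h1 h2
    have h1 := same hE hp s1 h1
    have h2 := same hE.flip hpz s2 h2
    have := hD.asymm x y
    have := hE.asymm x y
    tauto
  have hqz : q ≠ z := by
    rintro rfl
    exact disj _ _ .refl .refl
  have hadj : K.Adj q z := by
    by_contra h
    exact disj _ _ (.step .refl hpz.1 hqz h) .refl
  have hq : ForcingClass K p q q z := by
    by_contra h
    obtain ⟨y, hy⟩ := ForcingClass.exists_of_isPathEdge hD hK hKc hp z
    exact ForcingClass.not_of_triangle hpz.1.symm hadj.symm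
      (fun h => disj _ _ h.swap .refl) (fun h' => h h'.swap) y hy
  obtain ⟨y, hy⟩ := ForcingClass.exists_of_isPathEdge hD hK hKc hpz q
  exact ForcingClass.not_of_triangle hp.1.symm hadj
    (fun h => disj _ _ .refl h.swap) (fun h => disj _ _ hq h) y hy

/-- The offset from `p` of the right far neighbor of `p + i`. -/
def reach {n : ℕ} (r : ZMod n → ℕ) (p : ZMod n) (i : ℕ) : ℕ := i + r (p + i)

theorem reach_mono {n : ℕ} {r : ZMod n → ℕ} (hr : IsRoundRep n r) (p : ZMod n) :
    Monotone (reach r p) := by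
  refine monotone_nat_of_le_succ fun i => ?_
  have := hr.2 (p + i)
  unfold reach
  push_cast
  rw [← add_assoc]
  omega

theorem reach_add_self {n : ℕ} (r : ZMod n → ℕ) (p : ZMod n) (i : ℕ) :
    reach r p (i + n) = reach r p i + n := by
  simp only [reach, Nat.cast_add, CharP.cast_eq_zero, add_zero]
  omega

theorem reach_zero {n : ℕ} (r : ZMod n → ℕ) (p : ZMod n) : reach r p 0 = r p := by
  simp [reach]

theorem reach_le_add {n : ℕ} {r : ZMod n → ℕ} (hr : IsRoundRep n r) (p : ZMod n) {i : ℕ}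
    (hi : i < n) : reach r p i ≤ n + reach r p 0 := by
  have := reach_mono hr p hi.le
  have := reach_add_self r p 0
  rw [zero_add] at this
  omega

theorem exists_offset {n : ℕ} (hn : 1 ≤ n) (p q : ZMod n) : ∃ i : ℕ, i < n ∧ q = p + i := by
  have : NeZero n := ⟨by omega⟩
  exact ⟨(q - p).val, ZMod.val_lt _, by simp⟩

theorem offset_injective {n : ℕ} {p : ZMod n} {i j : ℕ} (hi : i < n) (hj : j < n)
    (h : p + (i : ZMod n) = p + j) : i = j := by
  have h := (ZMod.natCast_eq_natCast_iff' i j n).1 (add_left_cancel h)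
  rwa [Nat.mod_eq_of_lt hi, Nat.mod_eq_of_lt hj] at h

theorem arrow_offset_iff {n : ℕ} {r : ZMod n → ℕ} (hr : IsRoundRep n r) (p : ZMod n) {i j : ℕ}
    (hi : i < n) (hj : j < n) : Arrow r (p + i) (p + j) ↔
      (i < j ∧ j ≤ reach r p i) ∨ (j < i ∧ n + j ≤ reach r p i) := by
  have hlt := hr.1 (p + i)
  unfold reach
  constructor
  · rintro ⟨k, h1, h2, h3⟩
    have h3 : p + (j : ZMod n) = p + ((i + k : ℕ) : ZMod n) := by
      rw [h3]; push_cast; ring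
    by_cases hk : i + k < n
    · have := offset_injective hj hk h3
      omega
    · have h4 : p + (j : ZMod n) = p + ((i + k - n : ℕ) : ZMod n) := by
        rw [h3, Nat.cast_sub (by omega)]
        simp
      have := offset_injective hj (by omega) h4
      omega
  · rintro (⟨h1, h2⟩ | ⟨h1, h2⟩)
    · refine ⟨j - i, by omega, by omega, ?_⟩
      rw [Nat.cast_sub h1.le]
      ring
    · refine ⟨n + j - i, by omega, by omega, ?_⟩
      rw [Nat.cast_sub (by omega)]
      push_cast
      simp

theorem arrow_to_base_iff {n : ℕ} {r : ZMod n → ℕ} (hr : IsRoundRep n r) (p : ZMod n) {i : ℕ}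
    (hi : i < n) : Arrow r (p + i) p ↔ 0 < i ∧ n ≤ reach r p i := by
  have := arrow_offset_iff hr p hi (j := 0) (by omega)
  simpa using this

theorem arrow_from_base_iff {n : ℕ} {r : ZMod n → ℕ} (hr : IsRoundRep n r) (p : ZMod n) {i : ℕ}
    (hi : i < n) : Arrow r p (p + i) ↔ 0 < i ∧ i ≤ reach r p 0 := by
  have := arrow_offset_iff hr p (i := 0) (by omega) hi
  simpa using this

theorem Arrow.ne {n : ℕ} {r : ZMod n → ℕ} (hr : IsRoundRep n r) {p q : ZMod n}
    (h : Arrow r p q) : p ≠ q := by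
  rintro rfl
  have hn : 0 < n := (Nat.zero_le _).trans_lt (hr.1 p)
  have := (arrow_from_base_iff hr p hn).1 (by simpa using h)
  omega

theorem roundGraph_adj_iff {n : ℕ} {r : ZMod n → ℕ} (hr : IsRoundRep n r) {p q : ZMod n} :
    (roundGraph r).Adj p q ↔ Arrow r p q ∨ Arrow r q p := by
  rw [roundGraph, SimpleGraph.fromRel_adj]
  exact ⟨And.right, fun h => ⟨h.elim (Arrow.ne hr) fun h => (Arrow.ne hr h).symm, h⟩⟩

theorem roundGraph_path {n : ℕ} {r : ZMod n → ℕ} (hr : IsRoundRep n r) {p q t : ZMod n}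
    (hq : (roundGraph r).Adj p q) (ht : (roundGraph r).Adj p t) (hne : q ≠ t)
    (hn : ¬ (roundGraph r).Adj q t) :
    (Arrow r q p ∧ Arrow r p t) ∨ (Arrow r t p ∧ Arrow r p q) := by
  have hpos : 1 ≤ n := (Nat.zero_le _).trans_lt (hr.1 p)
  obtain ⟨i, hi, rfl⟩ := exists_offset hpos p q
  obtain ⟨j, hj, rfl⟩ := exists_offset hpos p t
  have hij : i ≠ j := fun h => hne (by rw [h])
  rw [roundGraph_adj_iff hr, arrow_to_base_iff hr p hi, arrow_from_base_iff hr p hi] at hq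
  rw [roundGraph_adj_iff hr, arrow_to_base_iff hr p hj, arrow_from_base_iff hr p hj] at ht
  rw [roundGraph_adj_iff hr, arrow_offset_iff hr p hi hj, arrow_offset_iff hr p hj hi] at hn
  rw [arrow_to_base_iff hr p hi, arrow_from_base_iff hr p hi, arrow_to_base_iff hr p hj,
    arrow_from_base_iff hr p hj]
  have := reach_mono hr p (Nat.zero_le i)
  have := reach_mono hr p (Nat.zero_le j)
  rcases lt_or_gt_of_ne hij with h | h
  · have := reach_mono hr p h.le
    omega
  · have := reach_mono hr p h.le
    omega

theorem IsRoundRepOf.isLocalOrientation {V : Type*} {G : SimpleGraph V} {n : ℕ}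
    {r : ZMod n → ℕ} {β : V → ZMod n} (h : IsRoundRepOf G n r β) :
    IsLocalOrientation G fun x y => Arrow r (β x) (β y) := by
  obtain ⟨hr, hnorm, -, hadj⟩ := h
  refine ⟨fun x y hxy hyx => hnorm _ _ (Arrow.ne hr hxy) ⟨hxy, hyx⟩, fun x y z hy hz hne hn => ?_⟩
  rw [hadj y z hne, not_or] at hn
  have hy' := (hadj x y hy.ne).1 hy
  have hz' := (hadj x z hz.ne).1 hz
  have hxy : β x ≠ β y := by
    intro h
    rw [h] at hz'
    tauto
  have hxz : β x ≠ β z := by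
    intro h
    rw [h] at hy'
    exact hn.2 (hy'.resolve_left (Ne.symm hn.1)).symm
  exact roundGraph_path hr (hy'.resolve_left hxy) (hz'.resolve_left hxz) hn.1 hn.2

/-- Distinct adjacent points of a block contig are distinguished by a third point. -/
theorem exists_distinguishing_point {n : ℕ} {r : ZMod n → ℕ} (hr : IsRoundRep n r)
    (hcomp : Compressed r) (huniv : {i : ZMod n | IsUniversalPt r i}.Subsingleton)
    {p q : ZMod n} (hpq : (roundGraph r).Adj p q) :
    ∃ t, Distinguishes (roundGraph r) p q t := by
  wlog h : Arrow r p q generalizing p q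
  · obtain ⟨t, h1, h2, h3⟩ := this hpq.symm (((roundGraph_adj_iff hr).1 hpq).resolve_left h)
    exact ⟨t, h2, h1, by tauto⟩
  by_contra hcon
  have htwin : ∀ t, t ≠ p → t ≠ q → ((roundGraph r).Adj p t ↔ (roundGraph r).Adj q t) := by
    intro t h1 h2
    by_contra h
    exact hcon ⟨t, h1, h2, by tauto⟩
  clear hcon
  have hpos : 1 ≤ n := (Nat.zero_le _).trans_lt (hr.1 p)
  obtain ⟨t, htp, ht⟩ : ∃ t, t ≠ p ∧ ¬ (roundGraph r).Adj p t := by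
    by_contra! hp
    refine hpq.ne (huniv (show IsUniversalPt r p from hp) (show IsUniversalPt r q from ?_))
    intro j hj
    by_cases hjp : j = p
    · exact hjp ▸ hpq.symm
    · exact (htwin j hjp hj).1 (hp j hjp)
  obtain ⟨k, hk, rfl⟩ := exists_offset hpos p q
  obtain ⟨τ, hτ, rfl⟩ := exists_offset hpos p t
  have hτ0 : τ ≠ 0 := by rintro rfl; simp at htp
  rw [roundGraph_adj_iff hr, arrow_to_base_iff hr p hτ, arrow_from_base_iff hr p hτ] at ht
  have hk' := (arrow_from_base_iff hr p hk).1 h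
  have adj : ∀ i, 0 < i → i ≠ k → i < n → (((0 < i ∧ i ≤ reach r p 0) ∨ (0 < i ∧ n ≤ reach r p i)) ↔
      (((k < i ∧ i ≤ reach r p k) ∨ (i < k ∧ n + i ≤ reach r p k)) ∨
        ((i < k ∧ k ≤ reach r p i) ∨ (k < i ∧ n + k ≤ reach r p i)))) := by
    intro i hi0 hik hi
    have := htwin (p + i) (fun h => by
        have := offset_injective hi hpos (p := p) (by simpa using h); omega)
      (fun h => hik (offset_injective hi hk h))
    rwa [roundGraph_adj_iff hr, roundGraph_adj_iff hr, arrow_to_base_iff hr p hi,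
      arrow_from_base_iff hr p hi, arrow_offset_iff hr p hi hk, arrow_offset_iff hr p hk hi] at this
  have hreach : reach r p k = reach r p 0 := by
    have h1 := reach_mono hr p (Nat.zero_le k)
    by_contra hne
    have h2 := reach_mono hr p (show reach r p 0 + 1 ≤ τ by omega)
    have h3 := adj (reach r p 0 + 1) (by omega) (by omega) (by omega)
    omega
  have hset : {j | Arrow r j (p + k)} =
      {j | Arrow r j p} ∪ (fun i : ℕ => p + (i : ZMod n)) '' (Finset.range k : Set ℕ) := by
    ext j
    obtain ⟨i, hi, rfl⟩ := exists_offset hpos p j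
    have himg : p + (i : ZMod n) ∈ (fun i : ℕ => p + (i : ZMod n)) '' (Finset.range k : Set ℕ) ↔
        i < k := by
      constructor
      · rintro ⟨i', hi', h⟩
        have hi' : i' < k := by simpa using hi'
        have := offset_injective (by omega) hi h
        omega
      · intro h
        exact ⟨i, by simpa using h, rfl⟩
    rw [Set.mem_union, himg, Set.mem_ofPred_eq, Set.mem_ofPred_eq, arrow_offset_iff hr p hi hk,
      arrow_to_base_iff hr p hi]
    have h0 := reach_mono hr p (Nat.zero_le i)
    rcases lt_trichotomy i k with h | h | h
    · omega
    · subst h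
      omega
    · have := adj i (by omega) (by omega) hi
      rcases le_total i τ with h' | h'
      · have := reach_mono hr p h'
        omega
      · omega
  have hcard : ({j | Arrow r j (p + k)} : Set (ZMod n)).ncard =
      ({j | Arrow r j p} : Set (ZMod n)).ncard + k := by
    have : NeZero n := ⟨by omega⟩
    rw [hset, Set.ncard_union_eq, Set.InjOn.ncard_image]
    · simp
    · intro i hi j hj hij
      have hi : i < k := by simpa using hi
      have hj : j < k := by simpa using hj
      exact offset_injective (by omega) (by omega) hij
    · rw [Set.disjoint_left]
      rintro _ hj ⟨i, hi, rfl⟩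
      have hi : i < k := by simpa using hi
      have := (arrow_to_base_iff hr p (by omega)).1 hj
      have := reach_mono hr p hi.le
      omega
  refine hpq.ne (hcomp p (p + k) ?_ ?_)
  · unfold Fl
    rw [hcard]
    push_cast
    ring
  · have : p + (k : ZMod n) + (r (p + k) : ZMod n) = p + ((reach r p k : ℕ) : ZMod n) := by
      unfold reach; push_cast; ring
    rw [Fr, Fr, this, hreach, reach_zero]

/-- Two non-adjacent points form a connectable pair as soon as the right neighbors of the first are
neighbors of the second and the left neighbors of the second are neighbors of the first. -/
theorem connectable_of_forall_adj {n : ℕ} {r : ZMod n → ℕ} (hr : IsRoundRep n r)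
    (hconn : (roundGraph r).Connected) {b a : ZMod n} (hab : a ≠ b)
    (hnadj : ¬ (roundGraph r).Adj b a) (h1 : ∀ p, Arrow r b p → (roundGraph r).Adj p a)
    (h2 : ∀ p, Arrow r p a → (roundGraph r).Adj p b) : Connectable r b a := by
  have hpos : 1 ≤ n := (Nat.zero_le _).trans_lt (hr.1 b)
  obtain ⟨m, hm, rfl⟩ := exists_offset hpos b a
  have hm0 : 0 < m := by
    rcases Nat.eq_zero_or_pos m with rfl | h
    · simp at hab
    · exact h
  rw [roundGraph_adj_iff hr, arrow_to_base_iff hr b hm, arrow_from_base_iff hr b hm] at hnadj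
  have h1' : ∀ j, 1 ≤ j → j ≤ reach r b 0 → m ≤ reach r b j := by
    intro j hj hj'
    have := h1 (b + j) ((arrow_from_base_iff hr b (by omega)).2 ⟨hj, hj'⟩)
    rw [roundGraph_adj_iff hr, arrow_offset_iff hr b hm (by omega),
      arrow_offset_iff hr b (by omega) hm] at this
    omega
  have h2' : ∀ i, 1 ≤ i → i < m → m ≤ reach r b i → i ≤ reach r b 0 := by
    intro i hi him hi'
    have := h2 (b + i) ((arrow_offset_iff hr b (by omega) hm).2 (Or.inl ⟨him, hi'⟩))
    rw [roundGraph_adj_iff hr, arrow_to_base_iff hr b (by omega),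
      arrow_from_base_iff hr b (by omega)] at this
    have := reach_mono hr b him.le
    omega
  have hb : reach r b 0 = m - 1 := by
    rcases Nat.eq_zero_or_pos (reach r b 0) with h0 | h0
    · by_contra hne
      have hlast : ¬ m ≤ reach r b (m - 1) := fun h => by
        have := h2' (m - 1) (by omega) (by omega) h
        omega
      obtain ⟨s, ⟨j, hj1, hjm, rfl⟩, t, ht, hst⟩ := exists_boundary_adj hconn.preconnected
        {x : ZMod n | ∃ j : ℕ, 1 ≤ j ∧ j < m ∧ x = b + j} (x := b + ((1 : ℕ) : ZMod n)) (y := b)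
        ⟨1, le_rfl, by omega, rfl⟩ (by
          rintro ⟨j, hj, hj', h⟩
          have := offset_injective hpos (show j < n by omega) (p := b) (by simpa using h)
          omega)
      obtain ⟨i, hi, rfl⟩ := exists_offset hpos b t
      have hi' : i = 0 ∨ m ≤ i := by
        by_contra hc
        exact ht ⟨i, by omega, by omega, rfl⟩
      rw [roundGraph_adj_iff hr, arrow_offset_iff hr b hi (by omega),
        arrow_offset_iff hr b (by omega) hi] at hst
      have := reach_mono hr b (show j ≤ m - 1 by omega)
      have := reach_le_add hr b hi
      rcases hi' with rfl | hi' <;> omega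
    · have := h1' 1 le_rfl h0
      by_contra hne
      have h3 := reach_mono hr b (show 1 ≤ m - 1 by omega)
      have := h2' (m - 1) (by omega) (by omega) (by omega)
      omega
  have hset : {j | Arrow r j (b + m)} =
      (fun i : ℕ => b + (i : ZMod n)) '' (Finset.Ico 1 m : Set ℕ) := by
    ext j
    obtain ⟨i, hi, rfl⟩ := exists_offset hpos b j
    rw [Set.mem_ofPred_eq, arrow_offset_iff hr b hi hm]
    constructor
    · intro h
      have h4 := reach_le_add hr b hi
      refine ⟨i, ?_, rfl⟩
      rw [Finset.coe_Ico, Set.mem_Ico]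
      rcases Nat.eq_zero_or_pos i with rfl | h5 <;> omega
    · rintro ⟨i', hi', h⟩
      rw [Finset.coe_Ico, Set.mem_Ico] at hi'
      have := offset_injective (by omega) hi h
      subst this
      exact Or.inl ⟨hi'.2, h1' i' hi'.1 (by omega)⟩
  have hcard : ({j | Arrow r j (b + m)} : Set (ZMod n)).ncard = m - 1 := by
    rw [hset, Set.InjOn.ncard_image]
    · simp
    · intro i hi j hj hij
      rw [Finset.coe_Ico, Set.mem_Ico] at hi hj
      exact offset_injective (by omega) (by omega) hij
  rw [reach_zero] at hb
  constructor
  · rw [Ur, Fr, hb, Nat.cast_sub hm0]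
    push_cast
    ring
  · rw [Ul, Fl, hcard, Nat.cast_sub hm0]
    push_cast
    ring

/-- If `c ⟶ d`, every point that is not within reach of both `c` and `d` lies strictly between `d`
and `c`. -/
theorem exists_offset_of_arrow {n : ℕ} {r : ZMod n → ℕ} (hr : IsRoundRep n r) {c d : ZMod n}
    {m : ℕ} (hm : m < n) (hc : c = d + m) (h : Arrow r c d) {t : ZMod n}
    (ht : ¬ ((t = c ∨ (roundGraph r).Adj t c) ∧ (t = d ∨ (roundGraph r).Adj t d))) :
    ∃ j : ℕ, 1 ≤ j ∧ j < m ∧ t = d + j := by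
  subst hc
  have hadj : (roundGraph r).Adj (d + m) d := (roundGraph_adj_iff hr).2 (Or.inl h)
  obtain ⟨j, hj, rfl⟩ := exists_offset (by omega) d t
  rw [arrow_to_base_iff hr d hm] at h
  refine ⟨j, Nat.pos_of_ne_zero ?_, ?_, rfl⟩
  · rintro rfl
    rw [Nat.cast_zero, add_zero] at ht
    exact ht ⟨Or.inr hadj.symm, Or.inl rfl⟩
  · by_contra hjm
    refine ht ⟨?_, Or.inr ((roundGraph_adj_iff hr).2 (Or.inl ((arrow_to_base_iff hr d hj).2 ?_)))⟩
    · rcases eq_or_ne j m with rfl | hne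
      · exact Or.inl rfl
      · refine Or.inr ((roundGraph_adj_iff hr).2 (Or.inr ((arrow_offset_iff hr d hm hj).2 ?_)))
        omega
    · have := reach_mono hr d (show m ≤ j by omega)
      omega

/-- In a non-straight representation, a transitive symmetric relation containing all adjacencies
within an arc relates any two vertices of the arc. -/
theorem IsRoundRepOf.rel_of_arc {V : Type*} {H : SimpleGraph V} {n : ℕ} {r : ZMod n → ℕ}
    {β : V → ZMod n} (h : IsRoundRepOf H n r β) (hns : ¬ IsStraight r) (p : ZMod n) {m : ℕ}
    {R : V → V → Prop} (hsymm : ∀ x y, R x y → R y x)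
    (htrans : ∀ x y z, R x y → R y z → R x z)
    (hR : ∀ x y (i j : ℕ), 1 ≤ i → i < m → 1 ≤ j → j < m → β x = p + i → β y = p + j →
      x = y ∨ H.Adj x y → R x y)
    {x y : V} {i j : ℕ} (hi1 : 1 ≤ i) (hi : i < m) (hj1 : 1 ≤ j) (hj : j < m)
    (hx : β x = p + i) (hy : β y = p + j) : R x y := by
  obtain ⟨hr, -, hsurj, hadj⟩ := h
  have key : ∀ d i : ℕ, ∀ x y : V, 1 ≤ i → i + d < m → β x = p + i →
      β y = p + ((i + d : ℕ) : ZMod n) → R x y := by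
    intro d
    induction d with
    | zero =>
      intro i x y hi hd hx hy
      refine hR x y i i hi hd hi hd hx hy ?_
      by_cases hxy : x = y
      · exact Or.inl hxy
      · exact Or.inr ((hadj x y hxy).2 (Or.inl (by rw [hx, hy, add_zero])))
    | succ d ih =>
      intro i x y hi hd hx hy
      obtain ⟨z, hz⟩ := hsurj (p + ((i + d : ℕ) : ZMod n))
      refine htrans x z y (ih i x z hi (by omega) hx hz)
        (hR z y _ _ (by omega) (by omega) (by omega) hd hz hy (Or.inr ?_))
      have harrow : Arrow r (β z) (β y) := by
        refine ⟨1, le_rfl, Nat.pos_of_ne_zero fun h => hns ⟨_, h⟩, ?_⟩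
        rw [hz, hy]
        push_cast
        ring
      have hne : z ≠ y := by
        rintro rfl
        exact Arrow.ne hr harrow rfl
      exact (hadj z y hne).2 (Or.inr ((roundGraph_adj_iff hr).2 (Or.inl harrow)))
  rcases le_total i j with hij | hij
  · exact key (j - i) i x y hi1 (by omega) hx (by rw [hy]; congr 2; omega)
  · exact hsymm _ _ (key (i - j) j y x hj1 (by omega) hy (by rw [hx]; congr 2; omega))

/-- Deleting a vertex from a graph with a non-straight representation leaves a connected graph. -/
theorem IsRoundRepOf.preconnected_delete {V : Type*} {H : SimpleGraph V} {n : ℕ}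
    {r : ZMod n → ℕ} {β : V → ZMod n} (h : IsRoundRepOf H n r β) (hns : ¬ IsStraight r) (v : V) :
    (H.induce {u : V | u ≠ v}).Preconnected := by
  have hn : 1 < n := by
    have h1 := h.1.1 (β v)
    have h2 : r (β v) ≠ 0 := fun h => hns ⟨_, h⟩
    omega
  let R : V → V → Prop := fun x y => ∃ (hx : x ≠ v) (hy : y ≠ v),
    (H.induce {u : V | u ≠ v}).Reachable ⟨x, hx⟩ ⟨y, hy⟩
  have hsymm : ∀ x y, R x y → R y x := fun x y ⟨hx, hy, h⟩ => ⟨hy, hx, h.symm⟩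
  have htrans : ∀ x y z, R x y → R y z → R x z :=
    fun x y z ⟨hx, _, h⟩ ⟨_, hz, h'⟩ => ⟨hx, hz, h.trans h'⟩
  have hRadj : ∀ x y, x ≠ v → y ≠ v → x = y ∨ H.Adj x y → R x y := by
    rintro x y hx hy (rfl | hxy)
    · exact ⟨hx, hx, SimpleGraph.Reachable.refl _⟩
    · exact ⟨hx, hy, SimpleGraph.Adj.reachable (by simpa using hxy)⟩
  have hnev : ∀ x (i : ℕ), 1 ≤ i → i < n → β x = β v + i → x ≠ v := by
    rintro x i hi hin hx rfl
    have := offset_injective (show 0 < n by omega) hin (p := β x) (by simpa using hx)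
    omega
  obtain ⟨u, hu⟩ := h.2.2.1 (β v + ((1 : ℕ) : ZMod n))
  have huv := hnev u 1 le_rfl hn hu
  have key : ∀ x, x ≠ v → R x u := by
    intro x hx
    obtain ⟨i, hi, hxi⟩ := exists_offset hn.le (β v) (β x)
    rcases Nat.eq_zero_or_pos i with rfl | hi0
    · have harrow : Arrow r (β x) (β u) :=
        ⟨1, le_rfl, Nat.pos_of_ne_zero fun h => hns ⟨_, h⟩, by rw [hu, hxi]; simp⟩
      have hne : x ≠ u := by
        rintro rfl
        exact Arrow.ne h.1 harrow rfl
      exact hRadj x u hx huv (Or.inr ((h.2.2.2 x u hne).2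
        (Or.inr ((roundGraph_adj_iff h.1).2 (Or.inl harrow)))))
    · exact h.rel_of_arc hns (β v) hsymm htrans
        (fun x y i j hi hin hj hjn hx hy => hRadj x y (hnev x i hi hin hx) (hnev y j hj hjn hy))
        hi0 hi le_rfl hn hxi hu
  rintro ⟨x, hx⟩ ⟨y, hy⟩
  obtain ⟨_, _, h⟩ := htrans x u y (key x hx) (hsymm _ _ (key y hy))
  exact h

theorem addEdge_adj_iff {V : Type*} {G : SimpleGraph V} {v w x y : V} (hvw : v ≠ w) :
    (addEdge G v w).Adj x y ↔ G.Adj x y ∨ (x = v ∧ y = w) ∨ (y = v ∧ x = w) := by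
  rw [addEdge, SimpleGraph.sup_adj, SimpleGraph.fromRel_adj]
  refine or_congr_right ⟨And.right, fun h => ⟨?_, h⟩⟩
  rintro rfl
  rcases h with ⟨h1, h2⟩ | ⟨h1, h2⟩ <;> exact hvw (h1.symm.trans h2)

/-- Local orientations of two graphs that coincide after deleting `v` are, up to reversal, equal on
the edges with ends distinguished by a vertex other than `v`. -/
theorem IsLocalOrientation.agree_or_flip_delete {V : Type*} {G H : SimpleGraph V}
    {D E : V → V → Prop} (hD : IsLocalOrientation G D) (hE : IsLocalOrientation H E) (v : V)
    (hGH : ∀ x y, x ≠ v → y ≠ v → (H.Adj x y ↔ G.Adj x y))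
    (hK : (H.induce {u : V | u ≠ v}).Preconnected)
    (hKc : ((G.induce {u : V | u ≠ v})ᶜ).Preconnected) :
    (∀ x y z, x ≠ v → y ≠ v → z ≠ v → G.Adj x y → Distinguishes G x y z →
      (D x y ∧ E x y) ∨ (D y x ∧ E y x)) ∨
    (∀ x y z, x ≠ v → y ≠ v → z ≠ v → G.Adj x y → Distinguishes G x y z →
      (D x y ∧ E y x) ∨ (D y x ∧ E x y)) := by
  have hind : H.induce {u : V | u ≠ v} = G.induce {u : V | u ≠ v} := by
    ext ⟨x, hx⟩ ⟨y, hy⟩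
    exact hGH x y hx hy
  have hD' : IsLocalOrientation (G.induce {u : V | u ≠ v}) fun x y => D x y :=
    ⟨fun x y => hD.asymm x y, fun x y z hy hz hne hn =>
      hD.path x y z hy hz (fun h => hne (Subtype.ext h)) hn⟩
  have hE' : IsLocalOrientation (G.induce {u : V | u ≠ v}) fun x y => E x y := by
    rw [← hind]
    exact ⟨fun x y => hE.asymm x y, fun x y z hy hz hne hn =>
      hE.path x y z hy hz (fun h => hne (Subtype.ext h)) hn⟩
  have hpath : ∀ x y z (hx : x ≠ v) (hy : y ≠ v), z ≠ v → G.Adj x y → Distinguishes G x y z →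
      IsPathEdge (G.induce {u : V | u ≠ v}) ⟨x, hx⟩ ⟨y, hy⟩ :=
    fun x y z hx hy hz hxy hd => ⟨hxy, ⟨z, hz⟩, fun h => hd.1 (congrArg Subtype.val h),
      fun h => hd.2.1 (congrArg Subtype.val h), hd.2.2⟩
  rw [hind] at hK
  rcases hD'.agree_or_flip hE' hK hKc with h | h
  · exact Or.inl fun x y z hx hy hz hxy hd => h _ _ (hpath x y z hx hy hz hxy hd)
  · exact Or.inr fun x y z hx hy hz hxy hd => h _ _ (hpath x y z hx hy hz hxy hd)

/-- The non-adjacent blocks of `w` and `v` are connectable if every neighbor of exactly one of the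
two vertices lies to the left of `w` or to the right of `v`. -/
theorem connectable_of_private_neighbors {V : Type*} {G : SimpleGraph V} {n : ℕ}
    {r : ZMod n → ℕ} {β : V → ZMod n} (hG : IsRoundRepOf G n r β)
    (hconn : (roundGraph r).Connected) {v w : V} (hab : β v ≠ β w)
    (hnadj : ¬ (roundGraph r).Adj (β v) (β w))
    (hx : ∀ x, G.Adj w x → ¬ G.Adj v x → β x ≠ β w → ¬ Arrow r (β w) (β x))
    (hy : ∀ y, G.Adj v y → ¬ G.Adj w y → β y ≠ β v → ¬ Arrow r (β y) (β v)) :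
    Connectable r (β w) (β v) := by
  obtain ⟨hr, -, hsurj, hadj⟩ := hG
  have hne : ∀ x y : V, β x ≠ β y → x ≠ y := fun x y h h' => h (h' ▸ rfl)
  refine connectable_of_forall_adj hr hconn hab (fun h => hnadj h.symm) ?_ ?_
  · intro p hp
    obtain ⟨x, rfl⟩ := hsurj p
    by_contra hpa
    have hwx := Arrow.ne hr hp
    have hvx : β v ≠ β x := fun h => hnadj ((roundGraph_adj_iff hr).2 (Or.inr (h ▸ hp)))
    refine hx x ((hadj w x (hne _ _ hwx)).2 (Or.inr ((roundGraph_adj_iff hr).2 (Or.inl hp)))) ?_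
      hwx.symm hp
    rw [hadj v x (hne _ _ hvx)]
    exact fun h => h.elim hvx fun h => hpa h.symm
  · intro p hp
    obtain ⟨y, rfl⟩ := hsurj p
    by_contra hpb
    have hvy := Arrow.ne hr hp
    have hwy : β w ≠ β y := fun h => hnadj ((roundGraph_adj_iff hr).2 (Or.inr (h ▸ hp)))
    refine hy y ((hadj v y (hne _ _ hvy.symm)).2
      (Or.inr ((roundGraph_adj_iff hr).2 (Or.inr hp)))) ?_ hvy hp
    rw [hadj w y (hne _ _ hwy)]
    exact fun h => h.elim hwy fun h => hpb h.symm

/-- The blocks of `v` and `w` are connectable in some order if a local orientation of `G + vw`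
agrees with the one of `G` on the edges from `v` and `w` to neighbors of exactly one of them. -/
theorem connectable_of_agree {V : Type*} {G : SimpleGraph V} {n : ℕ} {r : ZMod n → ℕ}
    {β : V → ZMod n} (hG : IsRoundRepOf G n r β) (hconn : (roundGraph r).Connected) {v w : V}
    (hab : β v ≠ β w) (hnadj : ¬ (roundGraph r).Adj (β v) (β w)) {E : V → V → Prop}
    (hE : IsLocalOrientation (addEdge G v w) E)
    (hx : ∀ x, G.Adj w x → ¬ G.Adj v x → β x ≠ β w →
      (Arrow r (β x) (β w) ∧ E x w) ∨ (Arrow r (β w) (β x) ∧ E w x))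
    (hy : ∀ y, G.Adj v y → ¬ G.Adj w y → β y ≠ β v →
      (Arrow r (β y) (β v) ∧ E y v) ∨ (Arrow r (β v) (β y) ∧ E v y)) :
    Connectable r (β v) (β w) ∨ Connectable r (β w) (β v) := by
  have hvw : v ≠ w := fun h => hab (h ▸ rfl)
  have hD := hG.isLocalOrientation
  have hx' : ∀ x, G.Adj w x → ¬ G.Adj v x → β x ≠ β w → (E v w ∧ E w x) ∨ (E x w ∧ E w v) := by
    intro x h1 h2 h3
    have hvx : v ≠ x := by
      rintro rfl
      exact hnadj (((hG.2.2.2 _ _ hvw.symm).1 h1).resolve_left h3.symm).symm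
    refine hE.path w v x ((addEdge_adj_iff hvw).2 (Or.inr (Or.inr ⟨rfl, rfl⟩)))
      ((addEdge_adj_iff hvw).2 (Or.inl h1)) hvx ?_
    rw [addEdge_adj_iff hvw]
    have := h1.ne
    tauto
  have hy' : ∀ y, G.Adj v y → ¬ G.Adj w y → β y ≠ β v → (E w v ∧ E v y) ∨ (E y v ∧ E v w) := by
    intro y h1 h2 h3
    have hwy : w ≠ y := by
      rintro rfl
      exact hnadj (((hG.2.2.2 _ _ hvw).1 h1).resolve_left h3.symm)
    refine hE.path v w y ((addEdge_adj_iff hvw).2 (Or.inr (Or.inl ⟨rfl, rfl⟩)))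
      ((addEdge_adj_iff hvw).2 (Or.inl h1)) hwy ?_
    rw [addEdge_adj_iff hvw]
    have := h1.ne
    tauto
  have hasymm := hE.asymm v w
  by_cases hwv : E w v
  · right
    refine connectable_of_private_neighbors hG hconn hab hnadj ?_ ?_
    · intro x h1 h2 h3 h4
      have := hx x h1 h2 h3
      have := hx' x h1 h2 h3
      have := hD.asymm x w
      have := hE.asymm x w
      tauto
    · intro y h1 h2 h3 h4
      have := hy y h1 h2 h3
      have := hy' y h1 h2 h3
      have := hD.asymm y v
      have := hE.asymm y v
      tauto
  · left
    refine connectable_of_private_neighbors hG hconn hab.symm (fun h => hnadj h.symm) ?_ ?_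
    · intro y h1 h2 h3 h4
      have := hy y h1 h2 h3
      have := hy' y h1 h2 h3
      have := hD.asymm y v
      have := hE.asymm y v
      tauto
    · intro x h1 h2 h3 h4
      have := hx x h1 h2 h3
      have := hx' x h1 h2 h3
      have := hD.asymm x w
      have := hE.asymm x w
      tauto

/-- If every edge of `G` avoiding `v` and `w` has ends distinguished by at most one of the sets of
vertices other than `v` and other than `w`, then a non-straight representation of `G + vw` leaves
no room for both a private neighbor of `v` and a private neighbor of `w`. -/
theorem false_of_private_neighbors {V : Type*} {G : SimpleGraph V} {v w : V} (hvw : v ≠ w)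
    {n : ℕ} {r : ZMod n → ℕ} {β : V → ZMod n} (hH : IsRoundRepOf (addEdge G v w) n r β)
    (hns : ¬ IsStraight r)
    (hno : ∀ x y z t, x ≠ v → x ≠ w → y ≠ v → y ≠ w → z ≠ v → t ≠ w → G.Adj x y →
      Distinguishes G x y z → ¬ Distinguishes G x y t)
    {x y : V} (hxv : x ≠ v) (hwx : G.Adj w x) (hvx : ¬ G.Adj v x)
    (hyw : y ≠ w) (hvy : G.Adj v y) (hwy : ¬ G.Adj w y) : False := by
  have hxw := hwx.ne'
  have hyv := hvy.ne'
  have hxy : ¬ G.Adj x y := fun h =>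
    hno x y w v hxv hxw hyv hyw hvw.symm hvw h
      ⟨hxw.symm, hyw.symm, Or.inl ⟨hwx.symm, fun h => hwy h.symm⟩⟩
      ⟨hxv.symm, hyv.symm, Or.inr ⟨fun h => hvx h.symm, hvy.symm⟩⟩
  have hxney : x ≠ y := by
    rintro rfl
    exact hvx hvy
  let R : V → V → Prop := fun p q =>
    (p ≠ v ∧ p ≠ w) ∧ (q ≠ v ∧ q ≠ w) ∧ (p = q ∨ G.Adj p q)
  have hsymm : ∀ p q, R p q → R q p :=
    fun p q ⟨h1, h2, h3⟩ => ⟨h2, h1, h3.imp Eq.symm SimpleGraph.Adj.symm⟩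
  have htrans : ∀ p q t, R p q → R q t → R p t := by
    rintro p q t ⟨hp, hq, hpq⟩ ⟨-, ht, hqt⟩
    refine ⟨hp, ht, ?_⟩
    rcases hpq with rfl | hpq
    · exact hqt
    rcases hqt with rfl | hqt
    · exact Or.inr hpq
    by_contra hc
    rw [not_or] at hc
    have hd : Distinguishes G p q t := ⟨Ne.symm hc.1, hqt.ne', Or.inr ⟨hc.2, hqt⟩⟩
    exact hno p q t t hp.1 hp.2 hq.1 hq.2 ht.1 ht.2 hpq hd hd
  have hr := hH.1
  have hnr : ∀ p q, p ≠ q → ¬ (addEdge G v w).Adj p q →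
      ¬ (β p = β q ∨ (roundGraph r).Adj (β p) (β q)) :=
    fun p q hpq h h' => h ((hH.2.2.2 p q hpq).2 h')
  have hxv' := hnr x v hxv (by
    rw [addEdge_adj_iff hvw]
    have := fun h : G.Adj x v => hvx h.symm
    tauto)
  have hyw' := hnr y w hyw (by
    rw [addEdge_adj_iff hvw]
    have := fun h : G.Adj y w => hwy h.symm
    tauto)
  have harc : ∀ (c d : V) (m : ℕ), ((c = v ∧ d = w) ∨ (c = w ∧ d = v)) → m < n →
      β c = β d + m → ¬ Arrow r (β c) (β d) := by
    intro c d m hcd hm hc harrow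
    obtain ⟨i, hi, him, hxi⟩ := exists_offset_of_arrow hr hm hc harrow (t := β x) (by
      rcases hcd with ⟨rfl, rfl⟩ | ⟨rfl, rfl⟩ <;> tauto)
    obtain ⟨j, hj, hjm, hyj⟩ := exists_offset_of_arrow hr hm hc harrow (t := β y) (by
      rcases hcd with ⟨rfl, rfl⟩ | ⟨rfl, rfl⟩ <;> tauto)
    have havoid : ∀ (p : V) (k : ℕ), 1 ≤ k → k < m → β p = β d + k → p ≠ v ∧ p ≠ w := by
      intro p k hk hkm hp
      have hpc : p ≠ c := by
        rintro rfl
        have := offset_injective hm (hkm.trans hm) (hc.symm.trans hp)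
        omega
      have hpd : p ≠ d := by
        rintro rfl
        have := offset_injective (show 0 < n by omega) (hkm.trans hm) (p := β p)
          (by simpa using hp)
        omega
      rcases hcd with ⟨rfl, rfl⟩ | ⟨rfl, rfl⟩
      exacts [⟨hpc, hpd⟩, ⟨hpd, hpc⟩]
    obtain ⟨-, -, h⟩ := hH.rel_of_arc hns (β d) (R := R) hsymm htrans (by
      intro p q i j hi him hj hjm hp hq hpq
      have hp' := havoid p i hi him hp
      refine ⟨hp', havoid q j hj hjm hq, hpq.imp_right fun h => ?_⟩
      rw [addEdge_adj_iff hvw] at h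
      tauto) hi him hj hjm hxi hyj
    exact h.elim hxney hxy
  have hn : 1 ≤ n := (Nat.zero_le _).trans_lt (hr.1 (β v))
  have hpath := hH.isLocalOrientation.path w v x
    ((addEdge_adj_iff hvw).2 (Or.inr (Or.inr ⟨rfl, rfl⟩)))
    ((addEdge_adj_iff hvw).2 (Or.inl hwx)) hxv.symm (by
      rw [addEdge_adj_iff hvw]
      tauto)
  rcases hpath with ⟨h, -⟩ | ⟨-, h⟩
  · obtain ⟨m, hm, hoff⟩ := exists_offset hn (β w) (β v)
    exact harc v w m (Or.inl ⟨rfl, rfl⟩) hm hoff h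
  · obtain ⟨m, hm, hoff⟩ := exists_offset hn (β v) (β w)
    exact harc w v m (Or.inr ⟨rfl, rfl⟩) hm hoff h

/-- In a block contig, adjacent vertices of distinct blocks are distinguished by a third vertex. -/
theorem IsBlockContigOf.exists_distinguishes {V : Type*} {G : SimpleGraph V} {n : ℕ}
    {r : ZMod n → ℕ} {β : V → ZMod n} (hG : IsBlockContigOf G n r β) {x y : V}
    (hxy : G.Adj x y) (hne : β x ≠ β y) : ∃ z, Distinguishes G x y z := by
  obtain ⟨⟨hr, -, hsurj, hadj⟩, hcomp, huniv, -⟩ := hG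
  obtain ⟨t, htx, hty, ht⟩ := exists_distinguishing_point hr hcomp huniv
    (((hadj x y hxy.ne).1 hxy).resolve_left hne)
  obtain ⟨z, rfl⟩ := hsurj t
  have hzx : z ≠ x := fun h => htx (h ▸ rfl)
  have hzy : z ≠ y := fun h => hty (h ▸ rfl)
  refine ⟨z, hzx, hzy, ?_⟩
  rw [hadj x z hzx.symm, hadj y z hzy.symm]
  have := Ne.symm htx
  have := Ne.symm hty
  tauto

theorem stmt15 {V : Type*} [Fintype V] (G : SimpleGraph V) (n : ℕ) (hn : 1 ≤ n)
    (r : ZMod n → ℕ) (β : V → ZMod n) (hbc : IsBlockContigOf G n r β)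
    (a b : ZMod n) (hab : a ≠ b) (hnadj : ¬ (roundGraph r).Adj a b)
    (v w : V) (hv : β v = a) (hw : β w = b)
    (hpca : IsPCA (addEdge G v w)) (hnpig : ¬ IsPIG (addEdge G v w))
    (hcv : ((G.induce {u : V | u ≠ v})ᶜ).Connected)
    (hcw : ((G.induce {u : V | u ≠ w})ᶜ).Connected) :
    Connectable r a b ∨ Connectable r b a := by
  obtain ⟨m, -, s, γ, hH⟩ := hpca
  have hns : ¬ IsStraight s := fun h =>
    hnpig ⟨m, (Nat.zero_le _).trans_lt (hH.1.1 (γ v)), s, γ, hH, h⟩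
  subst hv hw
  have hG := hbc.1
  have hvw : v ≠ w := fun h => hab (h ▸ rfl)
  have hnvw : ¬ G.Adj v w := fun h => hnadj (((hG.2.2.2 v w hvw).1 h).resolve_left hab)
  have hD := hG.isLocalOrientation
  have hE := hH.isLocalOrientation
  have hv := hD.agree_or_flip_delete hE v
    (fun x y hx hy => by rw [addEdge_adj_iff hvw]; tauto)
    (hH.preconnected_delete hns v) hcv.preconnected
  have hw := hD.agree_or_flip_delete hE w
    (fun x y hx hy => by rw [addEdge_adj_iff hvw]; tauto)
    (hH.preconnected_delete hns w) hcw.preconnected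
  have hx : ∀ x, G.Adj w x → ¬ G.Adj v x → β x ≠ β w →
      x ≠ v ∧ ∃ z, z ≠ v ∧ Distinguishes G x w z := by
    intro x h1 h2 h3
    obtain ⟨z, hz⟩ := hbc.exists_distinguishes h1.symm h3
    refine ⟨fun h => hnvw (h ▸ h1).symm, z, ?_, hz⟩
    rintro rfl
    exact hz.2.2.elim (fun h => h2 h.1.symm) fun h => hnvw h.2.symm
  have hy : ∀ y, G.Adj v y → ¬ G.Adj w y → β y ≠ β v →
      y ≠ w ∧ ∃ z, z ≠ w ∧ Distinguishes G y v z := by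
    intro y h1 h2 h3
    obtain ⟨z, hz⟩ := hbc.exists_distinguishes h1.symm h3
    refine ⟨fun h => hnvw (h ▸ h1), z, ?_, hz⟩
    rintro rfl
    exact hz.2.2.elim (fun h => h2 h.1.symm) fun h => hnvw h.2
  have agree_x : ∀ {E : V → V → Prop}, (∀ x y z, x ≠ v → y ≠ v → z ≠ v → G.Adj x y →
      Distinguishes G x y z → (Arrow r (β x) (β y) ∧ E x y) ∨ (Arrow r (β y) (β x) ∧ E y x)) →
      ∀ x, G.Adj w x → ¬ G.Adj v x → β x ≠ β w →
      (Arrow r (β x) (β w) ∧ E x w) ∨ (Arrow r (β w) (β x) ∧ E w x) := by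
    intro E hE x h1 h2 h3
    obtain ⟨h4, z, h5, h6⟩ := hx x h1 h2 h3
    exact hE x w z h4 hvw.symm h5 h1.symm h6
  have agree_y : ∀ {E : V → V → Prop}, (∀ x y z, x ≠ w → y ≠ w → z ≠ w → G.Adj x y →
      Distinguishes G x y z → (Arrow r (β x) (β y) ∧ E x y) ∨ (Arrow r (β y) (β x) ∧ E y x)) →
      ∀ y, G.Adj v y → ¬ G.Adj w y → β y ≠ β v →
      (Arrow r (β y) (β v) ∧ E y v) ∨ (Arrow r (β v) (β y) ∧ E v y) := by
    intro E hE y h1 h2 h3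
    obtain ⟨h4, z, h5, h6⟩ := hy y h1 h2 h3
    exact hE y v z h4 hvw h5 h1.symm h6
  have finish : ∀ {E : V → V → Prop}, IsLocalOrientation (addEdge G v w) E →
      (∀ x, G.Adj w x → ¬ G.Adj v x → β x ≠ β w →
        (Arrow r (β x) (β w) ∧ E x w) ∨ (Arrow r (β w) (β x) ∧ E w x)) →
      (∀ y, G.Adj v y → ¬ G.Adj w y → β y ≠ β v →
        (Arrow r (β y) (β v) ∧ E y v) ∨ (Arrow r (β v) (β y) ∧ E v y)) →
      Connectable r (β v) (β w) ∨ Connectable r (β w) (β v) :=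
    connectable_of_agree hG hbc.2.2.2 hab hnadj
  have mixed : (∀ x y z t, x ≠ v → x ≠ w → y ≠ v → y ≠ w → z ≠ v → t ≠ w → G.Adj x y →
      Distinguishes G x y z → ¬ Distinguishes G x y t) →
      Connectable r (β v) (β w) ∨ Connectable r (β w) (β v) := by
    intro hno
    by_cases h : ∃ x, G.Adj w x ∧ ¬ G.Adj v x ∧ β x ≠ β w
    · obtain ⟨x, h1, h2, h3⟩ := h
      have hnone : ∀ y, G.Adj v y → ¬ G.Adj w y → β y ≠ β v → False := fun y h4 h5 h6 =>
        false_of_private_neighbors hvw hH hns hno (hx x h1 h2 h3).1 h1 h2 (hy y h4 h5 h6).1 h4 h5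
      rcases hv with hv | hv
      · exact finish hE (agree_x hv) fun y h4 h5 h6 => (hnone y h4 h5 h6).elim
      · exact finish hE.flip (agree_x hv) fun y h4 h5 h6 => (hnone y h4 h5 h6).elim
    · have hnone : ∀ x, G.Adj w x → ¬ G.Adj v x → β x ≠ β w → False :=
        fun x h4 h5 h6 => h ⟨x, h4, h5, h6⟩
      rcases hw with hw | hw
      · exact finish hE (fun x h4 h5 h6 => (hnone x h4 h5 h6).elim) (agree_y hw)
      · exact finish hE.flip (fun x h4 h5 h6 => (hnone x h4 h5 h6).elim) (agree_y hw)
  rcases hv with hv' | hv' <;> rcases hw with hw' | hw'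
  · exact finish hE (agree_x hv') (agree_y hw')
  · refine mixed fun x y z t hxv hxw hyv hyw hz ht hxy hdz hdt => ?_
    have := hv' x y z hxv hyv hz hxy hdz
    have := hw' x y t hxw hyw ht hxy hdt
    have := hD.asymm x y
    have := hE.asymm x y
    tauto
  · refine mixed fun x y z t hxv hxw hyv hyw hz ht hxy hdz hdt => ?_
    have := hv' x y z hxv hyv hz hxy hdz
    have := hw' x y t hxw hyw ht hxy hdt
    have := hD.asymm x y
    have := hE.asymm x y
    tauto
  · exact finish hE.flip (agree_x hv') (agree_y hw')
end
end

section
/- Let G be a finite simple graph with a block contig (r, β) on ZMod n, let a ≠ b be points that are non-adjacent in 𝒢(r), and let v ∈ β⁻¹(a) and w ∈ β⁻¹(b). If the graph G + vw is a PCA graph but not a PIG graph, the complement of G is connected, and neither the complement of G ∖ {v} nor the complement of G ∖ {w} is connected, then at least one of ⟨a, b⟩ and ⟨b, a⟩ is connectable. -/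
open Classical

noncomputable section

/-- If `w` is a cut vertex of the complement of `G` and `v ≠ w`, the part `S` of the complement
of `G ∖ {w}` around `v` is separated from some co-neighbor `q` of `w`. -/
lemma exists_separated_coNbr {V : Type*} (G : SimpleGraph V) {v w : V} (hvw : v ≠ w)
    (hcc : (Gᶜ).Connected) (hcw : ¬ ((G.induce {u : V | u ≠ w})ᶜ).Connected) :
    ∃ (S : Set V) (q : V), v ∈ S ∧ w ∉ S ∧ q ∉ S ∧ q ≠ w ∧ ¬ G.Adj w q ∧
      ∀ x ∈ S, ∀ y, y ∉ S → y ≠ w → G.Adj x y := by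
  set K := (G.induce {u : V | u ≠ w})ᶜ with hK
  set S : Set V := {x | ∃ hx : x ≠ w, K.Reachable ⟨v, hvw⟩ ⟨x, hx⟩} with hS
  have hvS : v ∈ S := ⟨hvw, SimpleGraph.Reachable.refl _⟩
  have hwS : w ∉ S := fun ⟨h, _⟩ => h rfl
  have hadj : ∀ x ∈ S, ∀ y, y ∉ S → y ≠ w → G.Adj x y := by
    rintro x ⟨hx, hr⟩ y hy hyw
    by_contra hn
    refine hy ⟨hyw, hr.trans (SimpleGraph.Adj.reachable ?_)⟩
    rw [hK, SimpleGraph.compl_adj]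
    refine ⟨fun h => hy ?_, fun h => hn (by simpa using h)⟩
    have hxy : x = y := congrArg Subtype.val h
    exact hxy ▸ (⟨hx, hr⟩ : x ∈ S)
  obtain ⟨u, huw, huS⟩ : ∃ u, u ≠ w ∧ u ∉ S := by
    by_contra! hcon
    refine hcw ((SimpleGraph.connected_iff_exists_forall_reachable _).2 ⟨⟨v, hvw⟩, ?_⟩)
    rintro ⟨x, hx⟩
    exact (hcon x hx).2
  obtain ⟨walk⟩ := hcc.preconnected u v
  obtain ⟨d, -, hd1, hd2⟩ := walk.exists_boundary_dart {x | x ≠ w ∧ x ∉ S} ⟨huw, huS⟩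
    (fun h => h.2 hvS)
  have hda : Gᶜ.Adj d.fst d.snd := d.adj
  rw [SimpleGraph.compl_adj] at hda
  have hsnd : d.snd = w := by
    by_contra hne
    have hin : d.snd ∈ S := by
      by_contra hn
      exact hd2 ⟨hne, hn⟩
    exact hda.2 (hadj _ hin _ hd1.2 hd1.1).symm
  exact ⟨S, d.fst, hvS, hwS, hd1.2, hd1.1, fun h => hda.2 (hsnd ▸ h.symm), hadj⟩

lemma arrow_add_natCast_iff {n : ℕ} {r : ZMod n → ℕ} (hr : ∀ i, r i < n) (a : ZMod n)
    {i j : ℕ} (hi : i < n) (hj : j < n) :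
    Arrow r (a + i) (a + j) ↔
      (i < j ∧ j ≤ i + r (a + i)) ∨ (j ≤ i ∧ j + n ≤ i + r (a + i)) := by
  have hri := hr (a + i)
  constructor
  · rintro ⟨k, hk1, hk2, hk⟩
    have h : ((j : ℕ) : ZMod n) = ((i + k : ℕ) : ZMod n) := by
      rw [add_assoc] at hk
      simpa using add_left_cancel hk
    rw [ZMod.natCast_eq_natCast_iff', Nat.mod_eq_of_lt hj] at h
    rcases lt_or_ge (i + k) n with hlt | hge
    · rw [Nat.mod_eq_of_lt hlt] at h
      omega
    · rw [Nat.mod_eq_sub_mod hge, Nat.mod_eq_of_lt (by omega)] at h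
      omega
  · rintro (⟨h1, h2⟩ | ⟨h1, h2⟩)
    · refine ⟨j - i, by omega, by omega, ?_⟩
      rw [add_assoc, ← Nat.cast_add, Nat.add_sub_cancel' h1.le]
    · refine ⟨j + n - i, by omega, by omega, ?_⟩
      rw [add_assoc, ← Nat.cast_add, Nat.add_sub_cancel' (by omega)]
      simp

lemma roundRep_end_mono {n : ℕ} {r : ZMod n → ℕ} (hr : ∀ i, r i ≤ r (i + 1) + 1)
    (a : ZMod n) : Monotone fun i : ℕ => i + r (a + i) := by
  refine monotone_nat_of_le_succ fun i => ?_
  have h := hr (a + i)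
  have e : a + ((i + 1 : ℕ) : ZMod n) = a + i + 1 := by push_cast; ring
  simp only [e]
  omega

lemma roundGraph_adj {n : ℕ} (r : ZMod n → ℕ) (i j : ZMod n) :
    (roundGraph r).Adj i j ↔ i ≠ j ∧ (Arrow r i j ∨ Arrow r j i) := by
  simp [roundGraph]

lemma roundGraph_adj_of_arrow_of_arrow {n : ℕ} {r : ZMod n → ℕ}
    (hrep : IsRoundRep n r) {x y z : ZMod n} (hy : Arrow r x y) (hz : Arrow r x z)
    (hyz : y ≠ z) : (roundGraph r).Adj y z := by
  obtain ⟨hr, hs⟩ := hrep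
  have mono := roundRep_end_mono hs x
  refine (roundGraph_adj r y z).2 ⟨hyz, ?_⟩
  obtain ⟨k, hk, hk', rfl⟩ := hy
  obtain ⟨l, hl, hl', rfl⟩ := hz
  have hrx := hr x
  have h0 : r (x + (0 : ℕ)) = r x := by simp
  have hk0 := mono (Nat.zero_le k)
  have hl0 := mono (Nat.zero_le l)
  simp only [h0] at hk0 hl0
  have hkl : k ≠ l := fun h => hyz (h ▸ rfl)
  rw [arrow_add_natCast_iff hr x (by omega) (by omega),
    arrow_add_natCast_iff hr x (by omega) (by omega)]
  omega

/-- An induced path `a ⟶ Q ⟶ P ⟶ b` forces `⟨b, a⟩` to be connectable as soon as `a, Q` have no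
common co-neighbor but `b`, and `b, P` have none but `a`. -/
lemma connectable_of_induced_path {n : ℕ} (hn : 1 ≤ n) {r : ZMod n → ℕ}
    (hrep : IsRoundRep n r) {a b Q P : ZMod n}
    (hab : ¬ (roundGraph r).Adj a b) (hneab : a ≠ b)
    (haP : ¬ (roundGraph r).Adj a P) (hneaP : a ≠ P)
    (hQb : ¬ (roundGraph r).Adj Q b) (hneQb : Q ≠ b)
    (haQ : Arrow r a Q) (hneaQ : a ≠ Q) (hQP : (roundGraph r).Adj Q P)
    (hPb : (roundGraph r).Adj P b)
    (hx : ∀ x, x ≠ b → x = a ∨ x = Q ∨ (roundGraph r).Adj x Q ∨ (roundGraph r).Adj a x)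
    (hy : ∀ y, y ≠ a → y = b ∨ y = P ∨ (roundGraph r).Adj y P ∨ (roundGraph r).Adj b y) :
    Connectable r b a := by
  have : NeZero n := ⟨by omega⟩
  have coord : ∀ x : ZMod n, ∃ i : ℕ, i < n ∧ x = a + i := fun x =>
    ⟨(x - a).val, ZMod.val_lt _, by simp⟩
  obtain ⟨hr, hs⟩ := hrep
  have mono := roundRep_end_mono hs a
  have key : ∀ {i j : ℕ}, i < n → j < n → (Arrow r (a + i) (a + j) ↔
      (i < j ∧ j ≤ i + r (a + i)) ∨ (j ≤ i ∧ j + n ≤ i + r (a + i))) :=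
    fun hi hj => arrow_add_natCast_iff hr a hi hj
  have inj : ∀ {i j : ℕ}, i < n → j < n → (a + (i : ZMod n) = a + j ↔ i = j) := by
    intro i j hi hj
    rw [add_right_inj, ZMod.natCast_eq_natCast_iff', Nat.mod_eq_of_lt hi, Nat.mod_eq_of_lt hj]
  have per' : r (a + (n : ℕ)) = r (a + (0 : ℕ)) := by simp
  generalize hR : (fun i : ℕ => r (a + i)) = R at *
  have hR' : ∀ i : ℕ, r (a + i) = R i := fun i => congrFun hR i
  have hlt : ∀ i, R i < n := fun i => by rw [← hR']; exact hr _
  simp only [hR'] at mono key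
  have mono' : ∀ {i j : ℕ}, i ≤ j → i + R i ≤ j + R j := fun h => mono h
  obtain ⟨q, hq, rfl⟩ := coord Q
  obtain ⟨p, hp, rfl⟩ := coord P
  obtain ⟨w, hw, rfl⟩ := coord b
  have ha0 : a = a + (0 : ℕ) := by simp
  have hn0 : 0 < n := hn
  have adj : ∀ {i j : ℕ}, i < n → j < n → ((roundGraph r).Adj (a + i) (a + j) ↔
      i ≠ j ∧ (((i < j ∧ j ≤ i + R i) ∨ (j ≤ i ∧ j + n ≤ i + R i)) ∨
        ((j < i ∧ i ≤ j + R j) ∨ (i ≤ j ∧ i + n ≤ j + R j)))) := by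
    intro i j hi hj
    rw [roundGraph_adj, key hi hj, key hj hi, Ne, inj hi hj]
  have hx' : ∀ i : ℕ, i < n → i ≠ w → i = 0 ∨ i = q ∨
      (roundGraph r).Adj (a + i) (a + q) ∨ (roundGraph r).Adj (a + (0 : ℕ)) (a + i) := by
    intro i hi hiw
    rw [← inj hi hn0, ← inj hi hq, ← ha0]
    exact hx _ fun h => hiw ((inj hi hw).1 h)
  have hy' : ∀ i : ℕ, i < n → i ≠ 0 → i = w ∨ i = p ∨
      (roundGraph r).Adj (a + i) (a + p) ∨ (roundGraph r).Adj (a + w) (a + i) := by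
    intro i hi hi0
    rw [← inj hi hw, ← inj hi hp]
    exact hy _ fun h => hi0 ((inj hi hn0).1 (by rw [← ha0]; exact h))
  have adj0 : ∀ {j : ℕ} {A : Prop}, ((roundGraph r).Adj (a + (0 : ℕ)) (a + j) ↔ A) →
      ((roundGraph r).Adj a (a + j) ↔ A) := fun h => by rwa [← ha0] at h
  have inj0 : ∀ {j : ℕ}, j < n → (a = a + (j : ZMod n) ↔ 0 = j) := fun h => by
    have := inj hn0 h
    rwa [← ha0] at this
  rw [adj0 (adj hn0 hw)] at hab
  rw [adj0 (adj hn0 hp)] at haP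
  rw [adj hq hw] at hQb
  rw [adj hq hp] at hQP
  rw [adj hp hw] at hPb
  replace haQ := (key hn0 hq).1 (by rwa [← ha0])
  rw [Ne, inj0 hw] at hneab
  rw [Ne, inj0 hp] at hneaP
  rw [Ne, inj0 hq] at hneaQ
  rw [Ne, inj hq hw] at hneQb
  have hl0 := hlt 0
  have hq0 : 0 < q ∧ q ≤ R 0 := by omega
  have hE0p : R 0 < p := by omega
  have hE0w : R 0 < w := by omega
  have hEw : w + R w < n := by omega
  have hEp : p + R p < n := by omega
  have hqp : p ≤ q + R q := by omega
  have hpw : p < w := by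
    by_contra h
    omega
  have hend : ∀ {i : ℕ}, i < n → i + R i ≤ n + R 0 := fun {i} hi => by
    have h := mono' hi.le
    rwa [show R n = R 0 by rw [← hR', ← hR', per']] at h
  have hEw' : w + R w = n - 1 := by
    by_contra h
    have hne : n - 1 ≠ w := by omega
    have h1 := hy' (n - 1) (by omega) (by omega)
    rw [adj (by omega) hp, adj hw (by omega)] at h1
    have h2 := mono' hpw.le
    have h3 := hend (show n - 1 < n by omega)
    omega
  have hin : ∀ i, w < i → i < n → n ≤ i + R i := by
    intro i hwi hi
    have h1 := hx' (w + 1) (by omega) (by omega)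
    rw [adj (by omega) hq, adj hn0 (by omega)] at h1
    have h2 := mono' (show w + 1 ≤ i from hwi)
    omega
  constructor
  · have hcast : ((w + R w + 1 : ℕ) : ZMod n) = 0 := by
      rw [hEw', Nat.sub_add_cancel hn, ZMod.natCast_self]
    push_cast at hcast
    rw [Ur, Fr, hR']
    linear_combination -hcast
  · have hset : {j : ZMod n | Arrow r j a} =
        (fun i : ℕ => a + (i : ZMod n)) '' (Finset.Ioo w n : Finset ℕ) := by
      ext x
      obtain ⟨i, hi, rfl⟩ := coord x
      have hiff : Arrow r (a + i) a ↔ w < i := by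
        conv_lhs => rw [show Arrow r (a + i) a = Arrow r (a + i) (a + (0 : ℕ)) by rw [← ha0]]
        rw [key hi hn0]
        have := @mono' i w
        have := hin i
        omega
      simp only [Set.mem_ofPred_eq, hiff, Set.mem_image, Finset.coe_Ioo, Set.mem_Ioo]
      constructor
      · exact fun h => ⟨i, ⟨h, hi⟩, rfl⟩
      · rintro ⟨j, ⟨hj1, hj2⟩, hj⟩
        exact (inj hj2 hi).1 hj ▸ hj1
    rw [Ul, Fl, hset, Set.InjOn.ncard_image, Set.ncard_coe_finset, Nat.card_Ioo]
    · have : (w : ZMod n) + ((n - w - 1 : ℕ) : ZMod n) + 1 = 0 := by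
        rw [← Nat.cast_add, ← Nat.cast_succ, show (w + (n - w - 1)).succ = n by omega]
        simp
      linear_combination this
    · intro i hi j hj hij
      simp only [Finset.coe_Ioo, Set.mem_Ioo] at hi hj
      exact (inj hi.2 hj.2).1 hij

theorem stmt16 {V : Type*} [Fintype V] (G : SimpleGraph V) (n : ℕ) (hn : 1 ≤ n)
    (r : ZMod n → ℕ) (β : V → ZMod n) (hbc : IsBlockContigOf G n r β)
    (a b : ZMod n) (hab : a ≠ b) (hnadj : ¬ (roundGraph r).Adj a b)
    (v w : V) (hv : β v = a) (hw : β w = b)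
    (hpca : IsPCA (addEdge G v w)) (hnpig : ¬ IsPIG (addEdge G v w))
    (hcc : (Gᶜ).Connected)
    (hcv : ¬ ((G.induce {u : V | u ≠ v})ᶜ).Connected)
    (hcw : ¬ ((G.induce {u : V | u ≠ w})ᶜ).Connected) :
    Connectable r a b ∨ Connectable r b a := by
  obtain ⟨⟨hrep, -, hsurj, hG⟩, -⟩ := hbc
  have hvw : v ≠ w := by rintro rfl; exact hab (hv.symm.trans hw)
  obtain ⟨S, q, hvS, hwS, hqS, hqw, hnwq, hS⟩ := exists_separated_coNbr G hvw hcc hcw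
  obtain ⟨T, p, hwT, hvT, hpT, hpv, hnvp, hT⟩ := exists_separated_coNbr G hvw.symm hcc hcv
  have hpS : p ∈ S := by
    by_contra h
    exact hnvp (hS v hvS p h fun e => hpT (e ▸ hwT))
  have hqp : G.Adj q p := (hS p hpS q hqS hqw).symm
  have hvq : G.Adj v q := hS v hvS q hqS hqw
  have hwp : G.Adj w p := hT w hwT p hpT hpv
  have hx : ∀ x, x ≠ w → x = q ∨ G.Adj x q ∨ G.Adj v x := fun x hxw => by
    by_cases h : x ∈ S
    · exact Or.inr (Or.inl (hS x h q hqS hqw))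
    · exact Or.inr (Or.inr (hS v hvS x h hxw))
  have hy : ∀ y, y ≠ v → y = p ∨ G.Adj y p ∨ G.Adj w y := fun y hyv => by
    by_cases h : y ∈ T
    · exact Or.inr (Or.inl (hT y h p hpT hpv))
    · exact Or.inr (Or.inr (hT w hwT y h hyv))
  have adj_of : ∀ {x y}, G.Adj x y → β x = β y ∨ (roundGraph r).Adj (β x) (β y) :=
    fun h => (hG _ _ h.ne).1 h
  have nadj_of : ∀ {x y}, x ≠ y → ¬ G.Adj x y → β x ≠ β y ∧ ¬ (roundGraph r).Adj (β x) (β y) :=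
    fun hne h => not_or.1 fun h' => h ((hG _ _ hne).2 h')
  have hQb := nadj_of hqw fun h => hnwq h.symm
  have hPa := nadj_of hpv.symm hnvp
  have hQP := adj_of hqp
  have haQ := adj_of hvq
  have hbP := adj_of hwp
  have hX : ∀ x, x ≠ β w → x = β v ∨ x = β q ∨ (roundGraph r).Adj x (β q) ∨
      (roundGraph r).Adj (β v) x := by
    intro x hxb
    obtain ⟨x, rfl⟩ := hsurj x
    rcases hx x fun e => hxb (e ▸ rfl) with h | h | h
    · exact Or.inr (Or.inl (h ▸ rfl))
    · exact (adj_of h).elim (fun e => Or.inr (Or.inl e)) fun e => Or.inr (Or.inr (Or.inl e))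
    · exact (adj_of h).elim (fun e => Or.inl e.symm) fun e => Or.inr (Or.inr (Or.inr e))
  have hY : ∀ y, y ≠ β v → y = β w ∨ y = β p ∨ (roundGraph r).Adj y (β p) ∨
      (roundGraph r).Adj (β w) y := by
    intro x hxb
    obtain ⟨x, rfl⟩ := hsurj x
    rcases hy x fun e => hxb (e ▸ rfl) with h | h | h
    · exact Or.inr (Or.inl (h ▸ rfl))
    · exact (adj_of h).elim (fun e => Or.inr (Or.inl e)) fun e => Or.inr (Or.inr (Or.inl e))
    · exact (adj_of h).elim (fun e => Or.inl e.symm) fun e => Or.inr (Or.inr (Or.inr e))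
  subst hv hw
  generalize β v = a, β w = b, β p = P, β q = Q at *
  have hQP' : (roundGraph r).Adj Q P :=
    hQP.resolve_left fun e => by
      subst e
      exact haQ.elim hPa.1 hPa.2
  have haQ' : (roundGraph r).Adj a Q :=
    haQ.resolve_left fun e => by
      subst e
      exact hPa.2 hQP'
  have hbP' : (roundGraph r).Adj b P :=
    hbP.resolve_left fun e => by
      subst e
      exact hQb.2 hQP'
  rcases ((roundGraph_adj r a Q).1 haQ').2 with h | h
  · exact Or.inr (connectable_of_induced_path hn hrep hnadj hab hPa.2 hPa.1 hQb.2 hQb.1 h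
      haQ'.ne hQP' hbP'.symm hX hY)
  · have h' : Arrow r b P := by
      rcases ((roundGraph_adj r b P).1 hbP').2 with h' | h'
      · exact h'
      rcases ((roundGraph_adj r Q P).1 hQP').2 with h₁ | h₁
      · exact absurd (roundGraph_adj_of_arrow_of_arrow hrep h h₁ hPa.1) hPa.2
      · exact absurd (roundGraph_adj_of_arrow_of_arrow hrep h₁ h' hQb.1) hQb.2
    exact Or.inl (connectable_of_induced_path hn hrep (fun e => hnadj e.symm) hab.symm
      (fun e => hQb.2 e.symm) hQb.1.symm (fun e => hPa.2 e.symm) hPa.1.symm h' hbP'.ne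
      hQP'.symm haQ'.symm hY hX)
end
end
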